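/- Let a state of PIF satisfy RQ'(l,m) for some 0 ≤ l < m ≤ N. Then at least one action is enabled, and the execution of any enabled action yields a state satisfying RQ'(l',m') for some l' ≥ l and m' ≥ m, or (when l = N−1 and m = N, via the execution of reflect) the state satisfying RP(N−1). -/

import Mathlib

/-- Values of the state variable of a PIF process: idle, requesting, replying. -/
inductive PSt where
  | idle | rq | rp
deriving DecidableEq

/-- A PIF state on the chain of `N` processes is valid if the root (process 1)
never holds `rp` and the leaf (process `N`) never holds `rq`. -/
def PifValid (N : ℕ) (st : ℕ → PSt) : Prop := st 1 ≠ PSt.rp ∧ st N ≠ PSt.rq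

/-- One step of the PIF program on the chain of `N` processes: `st'` is
obtained from `st` by executing one enabled action (request, clear, forward,
back, stop, reflect or reset). -/
def pifStep (N : ℕ) (st st' : ℕ → PSt) : Prop :=
  -- request (root)
  (st 1 = PSt.idle ∧ st 2 = PSt.idle ∧ st' = Function.update st 1 PSt.rq) ∨
  -- clear (root)
  (st 1 = PSt.rq ∧ st 2 = PSt.rp ∧ st' = Function.update st 1 PSt.idle) ∨
  -- forward (intermediate)
  (∃ j, 2 ≤ j ∧ j ≤ N - 1 ∧ st (j - 1) = PSt.rq ∧ st j = PSt.idle ∧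
    st (j + 1) = PSt.idle ∧ st' = Function.update st j PSt.rq) ∨
  -- back (intermediate)
  (∃ j, 2 ≤ j ∧ j ≤ N - 1 ∧ st (j - 1) = PSt.rq ∧ st j = PSt.rq ∧
    st (j + 1) = PSt.rp ∧ st' = Function.update st j PSt.rp) ∨
  -- stop (intermediate)
  (∃ j, 2 ≤ j ∧ j ≤ N - 1 ∧ st (j - 1) = PSt.idle ∧ st j ≠ PSt.idle ∧
    st' = Function.update st j PSt.idle) ∨
  -- reflect (leaf)
  (st (N - 1) = PSt.rq ∧ st N = PSt.idle ∧ st' = Function.update st N PSt.rp) ∨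
  -- reset (leaf)
  (st (N - 1) = PSt.idle ∧ st N = PSt.rp ∧ st' = Function.update st N PSt.idle)

/-- `RP N k st`: the `k` leftmost processes are requesting and the rest are
replying (`1 ≤ k ≤ N - 1`). -/
def RP (N k : ℕ) (st : ℕ → PSt) : Prop :=
  1 ≤ k ∧ k ≤ N - 1 ∧
  (∀ j, 1 ≤ j → j ≤ k → st j = PSt.rq) ∧
  (∀ j, k < j → j ≤ N → st j = PSt.rp)

/-- `RQ N l m st`: the `l` leftmost processes are requesting, processes
`l+1 .. m` are idle, and the rest are replying (`0 ≤ l < m ≤ N`). -/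
def RQ (N l m : ℕ) (st : ℕ → PSt) : Prop :=
  l < m ∧ m ≤ N ∧
  (∀ j, 1 ≤ j → j ≤ l → st j = PSt.rq) ∧
  (∀ j, l < j → j ≤ m → st j = PSt.idle) ∧
  (∀ j, m < j → j ≤ N → st j = PSt.rp)

/-- `RP' N k st`: the `k` leftmost processes are requesting, process `k+1` is
replying, and no process beyond `k+1` is idle (`1 ≤ k ≤ N - 1`). -/
def RP' (N k : ℕ) (st : ℕ → PSt) : Prop :=
  1 ≤ k ∧ k ≤ N - 1 ∧
  (∀ j, 1 ≤ j → j ≤ k → st j = PSt.rq) ∧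
  st (k + 1) = PSt.rp ∧
  (∀ j, k + 1 < j → j ≤ N → st j ≠ PSt.idle)

/-- `RQ' N l m st`: the `l` leftmost processes are requesting, processes
`l+1 .. m` are idle, and the remaining processes are arbitrary
(`0 ≤ l < m ≤ N`). -/
def RQ' (N l m : ℕ) (st : ℕ → PSt) : Prop :=
  l < m ∧ m ≤ N ∧
  (∀ j, 1 ≤ j → j ≤ l → st j = PSt.rq) ∧
  (∀ j, l < j → j ≤ m → st j = PSt.idle)

/-- Updating a process beyond `m` preserves `RQ' l m`. -/
theorem rq'_update_far {N l m j : ℕ} {st : ℕ → PSt} (v : PSt) (h : RQ' N l m st) (hj : m < j) :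
    RQ' N l m (Function.update st j v) := by
  obtain ⟨h1, h2, h3, h4⟩ := h
  refine ⟨h1, h2, fun k hk hk' => ?_, fun k hk hk' => ?_⟩
  · rw [Function.update_of_ne (by omega)]; exact h3 k hk hk'
  · rw [Function.update_of_ne (by omega)]; exact h4 k hk hk'

/-- Process `l+1` becomes requesting while `l+2` is idle. -/
theorem rq'_update_next {N l m : ℕ} {st : ℕ → PSt} (h : RQ' N l m st) (hl : l + 2 ≤ N)
    (hi : st (l + 2) = PSt.idle) :
    RQ' N (l + 1) (max m (l + 2)) (Function.update st (l + 1) PSt.rq) := by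
  obtain ⟨h1, h2, h3, h4⟩ := h
  refine ⟨by omega, by omega, fun k hk hk' => ?_, fun k hk hk' => ?_⟩
  · by_cases e : k = l + 1
    · subst e; simp
    · rw [Function.update_of_ne e]; exact h3 k hk (by omega)
  · rw [Function.update_of_ne (by omega)]
    by_cases e : k = l + 2
    · subst e; exact hi
    · exact h4 k (by omega) (by omega)

/-- From a state satisfying `RQ' l m` (`0 ≤ l < m ≤ N`) at least one action is
enabled, and any enabled action yields a state satisfying `RQ' l' m'` for some
`l' ≥ l` and `m' ≥ m`, or (when `l = N-1` and `m = N`, via `reflect`) the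
state satisfying `RP (N-1)`. -/
theorem pif_rq'_progress (N : ℕ) (hN : 3 ≤ N)
    (st : ℕ → PSt) (hv : PifValid N st)
    (l m : ℕ) (h : RQ' N l m st) :
    (∃ st', pifStep N st st') ∧
    (∀ st', pifStep N st st' →
      (∃ l' m', l ≤ l' ∧ m ≤ m' ∧ RQ' N l' m' st') ∨
      (l = N - 1 ∧ m = N ∧ st' = Function.update st N PSt.rp ∧
        RP N (N - 1) st')) := by
  have h0 := h
  obtain ⟨h1, h2, h3, h4⟩ := h
  constructor
  · have adv : l + 2 ≤ N → st (l + 2) = PSt.idle → ∃ st', pifStep N st st' := by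
      intro hl hi
      have hs := h4 (l + 1) (by omega) (by omega)
      rcases Nat.eq_zero_or_pos l with rfl | hp
      · exact ⟨_, Or.inl ⟨hs, hi, rfl⟩⟩
      · exact ⟨_, Or.inr (Or.inr (Or.inl ⟨l + 1, by omega, by omega,
          h3 l hp le_rfl, hs, hi, rfl⟩))⟩
    have hm := h4 m h1 le_rfl
    by_cases hmN : m = N
    · by_cases hl : l = N - 1
      · exact ⟨_, Or.inr (Or.inr (Or.inr (Or.inr (Or.inr (Or.inl
          ⟨h3 (N - 1) (by omega) (by omega), hmN ▸ hm, rfl⟩)))))⟩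
      · exact adv (by omega) (h4 _ (by omega) (by omega))
    · by_cases hi : st (m + 1) = PSt.idle
      · refine adv (by omega) ?_
        by_cases e : l + 2 = m + 1
        · rw [e]; exact hi
        · exact h4 _ (by omega) (by omega)
      · by_cases e : m + 1 = N
        · have hrp : st N = PSt.rp := by
            have := hv.2
            rw [e] at hi
            cases hs : st N <;> simp_all
          refine ⟨_, Or.inr (Or.inr (Or.inr (Or.inr (Or.inr (Or.inr
            ⟨?_, hrp, rfl⟩)))))⟩
          rw [← e]; exact hm
        · exact ⟨_, Or.inr (Or.inr (Or.inr (Or.inr (Or.inl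
            ⟨m + 1, by omega, by omega, hm, hi, rfl⟩))))⟩
  · have far : ∀ j v, m < j → ∃ l' m', l ≤ l' ∧ m ≤ m' ∧ RQ' N l' m' (Function.update st j v) :=
      fun j v hj => ⟨l, m, le_rfl, le_rfl, rq'_update_far v h0 hj⟩
    have next : ∀ j, j = l + 1 → j + 1 ≤ N → st (j + 1) = PSt.idle →
        ∃ l' m', l ≤ l' ∧ m ≤ m' ∧ RQ' N l' m' (Function.update st j PSt.rq) := by
      rintro j rfl hj hi
      exact ⟨_, _, by omega, le_max_left _ _, rq'_update_next h0 hj hi⟩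
    rintro st' (⟨a, b, rfl⟩ | ⟨a, b, rfl⟩ | ⟨j, hj, hj', a, b, c, rfl⟩ |
      ⟨j, hj, hj', a, b, c, rfl⟩ | ⟨j, hj, hj', a, b, rfl⟩ | ⟨a, b, rfl⟩ | ⟨a, b, rfl⟩)
    · left
      refine next 1 ?_ (by omega) b
      by_contra hne
      have := h3 1 le_rfl (by omega)
      simp_all
    · exfalso
      by_cases hl : 2 ≤ l
      · have := h3 2 (by omega) hl
        simp_all
      · by_cases hl1 : l = 1
        · have := h4 2 (by omega) (by omega)
          simp_all
        · have := h4 1 (by omega) (by omega)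
          simp_all
    · left
      by_cases e1 : m < j
      · exact far j _ e1
      · refine next j ?_ (by omega) c
        by_contra hne
        by_cases e2 : j ≤ l
        · have := h3 j (by omega) e2
          simp_all
        · have := h4 (j - 1) (by omega) (by omega)
          simp_all
    · left
      refine far j _ ?_
      by_contra hne
      by_cases e2 : j ≤ l
      · by_cases e3 : j + 1 ≤ l
        · have := h3 (j + 1) (by omega) e3
          simp_all
        · have := h4 (j + 1) (by omega) (by omega)
          simp_all
      · have := h4 j (by omega) (by omega)
        simp_all
    · left
      refine far j _ ?_
      by_contra hne
      by_cases e2 : j ≤ l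
      · have := h3 (j - 1) (by omega) (by omega)
        simp_all
      · exact b (h4 j (by omega) (by omega))
    · by_cases e : m = N
      · right
        have hl : l = N - 1 := by
          by_contra hne
          have := h4 (N - 1) (by omega) (by omega)
          simp_all
        refine ⟨hl, e, rfl, by omega, le_rfl, fun k hk hk' => ?_, fun k hk hk' => ?_⟩
        · rw [Function.update_of_ne (by omega)]; exact h3 k hk (by omega)
        · have : k = N := by omega
          subst this; simp
      · exact Or.inl (far N _ (by omega))
    · left
      refine far N _ ?_
      by_contra hne
      have := h4 N (by omega) (by omega)
      simp_all
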